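/- Let ℓ, u be reals with 0 ≤ ℓ < u, let n ≥ 2 be an integer, and let 1 < p ≤ 2. Then the volume function V_p has a unique minimizer on the domain D. -/

import Mathlib

/-- The full sequence of linearization points: `ξ 0 = ℓ`, `ξ n = u`,
interior coordinates given by `x`. -/
noncomputable def xiSeq (l u : ℝ) (n : ℕ) (x : Fin (n - 1) → ℝ) (i : ℕ) : ℝ :=
  if h : 0 < i ∧ i < n then x ⟨i - 1, by omega⟩ else if i = 0 then l else u

/-- The open domain `D = {ℓ < ξ₁ < ⋯ < ξ_{n-1} < u}`. -/
def domD (l u : ℝ) (n : ℕ) : Set (Fin (n - 1) → ℝ) :=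
  {x | ∀ i < n, xiSeq l u n x i < xiSeq l u n x (i + 1)}

/-- The volume function `V_p` of the perspective relaxation of the piecewise-linear
under-estimator of `x^p` with linearization points `ℓ = ξ₀ < ξ₁ < ⋯ < ξ_n = u`. -/
noncomputable def Vp (l u p : ℝ) (n : ℕ) (x : Fin (n - 1) → ℝ) : ℝ :=
  -((p - 1) ^ 2 / (6 * p)) * ∑ i ∈ Finset.Icc 1 n,
      (xiSeq l u n x (i - 1)) ^ (p - 1) * (xiSeq l u n x i) ^ (p - 1)
        * (xiSeq l u n x i - xiSeq l u n x (i - 1)) ^ 2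
        / ((xiSeq l u n x i) ^ (p - 1) - (xiSeq l u n x (i - 1)) ^ (p - 1))
  + ((p - 1) / (6 * p)) * (u ^ (p + 1) - l ^ (p + 1)) - (1 / 6) * (u ^ p * l - u * l ^ p)



noncomputable def wq (q a b : ℝ) : ℝ := a ^ q * b ^ q * (b - a) / (b ^ q - a ^ q)
noncomputable def fq (q a b : ℝ) : ℝ := a ^ q * b ^ q * (b - a) ^ 2 / (b ^ q - a ^ q)

lemma fq_eq (q a b : ℝ) : fq q a b = (b - a) * wq q a b := by
  unfold fq wq; ring

lemma wq_zero {q : ℝ} (hq : 0 < q) (b : ℝ) : wq q 0 b = 0 := by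
  simp [wq, Real.zero_rpow hq.ne']

lemma fq_self (q a : ℝ) : fq q a a = 0 := by simp [fq]

lemma rneg_lt {q a b : ℝ} (hq : 0 < q) (ha : 0 < a) (hab : a < b) : b ^ (-q) < a ^ (-q) :=
  Real.rpow_lt_rpow_of_neg ha hab (by linarith)

lemma wq_eq {q a b : ℝ} (hq : 0 < q) (ha : 0 < a) (hab : a < b) :
    wq q a b = (b - a) / (a ^ (-q) - b ^ (-q)) := by
  have hb : 0 < b := ha.trans hab
  have h1 : a ^ q < b ^ q := Real.rpow_lt_rpow ha.le hab hq
  have h2 : 0 < a ^ q := Real.rpow_pos_of_pos ha q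
  have h3 : 0 < b ^ q := Real.rpow_pos_of_pos hb q
  have h4 := rneg_lt hq ha hab
  unfold wq
  rw [div_eq_div_iff (by linarith) (by linarith), Real.rpow_neg ha.le, Real.rpow_neg hb.le]
  field_simp

lemma wq_nonneg {q a b : ℝ} (hq : 0 < q) (ha : 0 ≤ a) (hab : a ≤ b) : 0 ≤ wq q a b := by
  have h1 : a ^ q ≤ b ^ q := Real.rpow_le_rpow ha hab hq.le
  have h2 : 0 ≤ a ^ q := Real.rpow_nonneg ha q
  have h3 : 0 ≤ b ^ q := Real.rpow_nonneg (ha.trans hab) q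
  exact div_nonneg (mul_nonneg (mul_nonneg h2 h3) (by linarith)) (by linarith)

lemma wq_pos {q a b : ℝ} (hq : 0 < q) (ha : 0 < a) (hab : a < b) : 0 < wq q a b := by
  rw [wq_eq hq ha hab]
  exact div_pos (by linarith) (by linarith [rneg_lt hq ha hab])

lemma slope_eq {q a b : ℝ} (ha : 0 < a) (hab : a < b) :
    ∃ t, a < t ∧ t < b ∧ a ^ (-q) - b ^ (-q) = q * t ^ (-(q + 1)) * (b - a) := by
  obtain ⟨t, ⟨h1, h2⟩, h3⟩ := exists_hasDerivAt_eq_slope (fun x : ℝ => x ^ (-q))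
    (fun x => (-q) * x ^ (-q - 1)) hab
    (fun x hx => (Real.continuousAt_rpow_const x (-q) (Or.inl (by linarith [hx.1] : 0 < x).ne')).continuousWithinAt)
    (fun x hx => Real.hasDerivAt_rpow_const (Or.inl (by linarith [hx.1] : 0 < x).ne'))
  refine ⟨t, h1, h2, ?_⟩
  rw [eq_div_iff (by linarith)] at h3
  rw [show -(q + 1) = -q - 1 by ring]
  linarith

lemma wq_mid {q a b : ℝ} (hq : 0 < q) (ha : 0 < a) (hab : a < b) :
    ∃ t, a < t ∧ t < b ∧ q * wq q a b = t ^ (q + 1) := by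
  obtain ⟨t, h1, h2, h3⟩ := slope_eq (q := q) ha hab
  refine ⟨t, h1, h2, ?_⟩
  have ht : 0 < t := ha.trans h1
  have := Real.rpow_pos_of_pos ht (q + 1)
  have : b - a ≠ 0 := by linarith
  rw [wq_eq hq ha hab, h3, Real.rpow_neg ht.le]
  field_simp

lemma wq_gt {q a b : ℝ} (hq : 0 < q) (ha : 0 < a) (hab : a < b) :
    a ^ (q + 1) < q * wq q a b := by
  obtain ⟨t, h1, h2, h3⟩ := wq_mid hq ha hab
  rw [h3]; exact Real.rpow_lt_rpow ha.le h1 (by linarith)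

lemma wq_lt {q a b : ℝ} (hq : 0 < q) (ha : 0 ≤ a) (hab : a < b) :
    q * wq q a b < b ^ (q + 1) := by
  rcases ha.eq_or_lt with rfl | ha
  · rw [wq_zero hq]; simpa using Real.rpow_pos_of_pos hab (q + 1)
  obtain ⟨t, h1, h2, h3⟩ := wq_mid hq ha hab
  rw [h3]; exact Real.rpow_lt_rpow (by linarith) h2 (by linarith)

lemma wq_hom {q c a b : ℝ} (hc : 0 < c) (ha : 0 ≤ a) (hb : 0 ≤ b) :
    wq q (c * a) (c * b) = c ^ (q + 1) * wq q a b := by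
  have := Real.rpow_pos_of_pos hc q
  unfold wq
  rw [Real.mul_rpow hc.le ha, Real.mul_rpow hc.le hb, Real.rpow_add hc, Real.rpow_one,
    ← mul_sub, ← mul_sub]
  by_cases h : b ^ q - a ^ q = 0
  · simp [h]
  · field_simp

/-- mediant-type strict inequality -/
lemma wq_three {q a b c : ℝ} (hq : 0 < q) (ha : 0 ≤ a) (hab : a < b) (hbc : b < c) :
    wq q a b < wq q b c := by
  have h1 := wq_lt hq ha hab
  have h2 := wq_gt hq (by linarith) hbc
  exact lt_of_mul_lt_mul_left (h1.trans h2) hq.le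

/-- strict superadditivity -/
lemma fq_super {q a b c : ℝ} (hq : 0 < q) (ha : 0 ≤ a) (hab : a < b) (hbc : b < c) :
    fq q a c < fq q a b + fq q b c := by
  rcases ha.eq_or_lt with rfl | ha
  · simp only [fq_eq, wq_zero hq]
    have := mul_pos (sub_pos.2 hbc) (wq_pos hq hab hbc)
    linarith
  have hb := ha.trans hab
  have h3 := wq_three hq ha.le hab hbc
  have d1 := rneg_lt hq ha hab
  have d2 := rneg_lt hq hb hbc
  simp only [fq_eq]
  rw [wq_eq hq ha hab, wq_eq hq hb hbc] at *
  rw [wq_eq hq ha (hab.trans hbc)]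
  generalize a ^ (-q) = A at *
  generalize b ^ (-q) = B at *
  generalize c ^ (-q) = C at *
  have e1 : 0 < A - B := by linarith
  have e2 : 0 < B - C := by linarith
  have e3 : 0 < A - C := by linarith
  rw [div_lt_div_iff₀ e1 e2] at h3
  rw [← sub_pos]
  have : (b - a) * ((b - a) / (A - B)) + (c - b) * ((c - b) / (B - C)) - (c - a) * ((c - a) / (A - C))
     = ((c - b) * (A - B) - (b - a) * (B - C)) ^ 2 / ((A - B) * (B - C) * (A - C)) := by
    field_simp; ring
  rw [this]
  have : 0 < (c - b) * (A - B) - (b - a) * (B - C) := by linarith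
  positivity

/-- monotone in the right endpoint -/
lemma wq_mono_right {q a b c : ℝ} (hq : 0 < q) (ha : 0 < a) (hab : a < b) (hbc : b < c) :
    wq q a b < wq q a c := by
  have hb := ha.trans hab
  have h3 := wq_three hq ha.le hab hbc
  have d1 := rneg_lt hq ha hab
  have d2 := rneg_lt hq hb hbc
  rw [wq_eq hq ha hab, wq_eq hq hb hbc] at *
  rw [wq_eq hq ha (hab.trans hbc)]
  rw [div_lt_div_iff₀ (by linarith) (by linarith)] at *
  linarith

lemma wq_mono_left {q a b c : ℝ} (hq : 0 < q) (ha : 0 ≤ a) (hab : a < b) (hbc : b < c) :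
    wq q a c < wq q b c := by
  rcases ha.eq_or_lt with rfl | ha
  · rw [wq_zero hq]; exact wq_pos hq hab hbc
  have hb := ha.trans hab
  have h3 := wq_three hq ha.le hab hbc
  have d1 := rneg_lt hq ha hab
  have d2 := rneg_lt hq hb hbc
  rw [wq_eq hq ha hab, wq_eq hq hb hbc] at *
  rw [wq_eq hq ha (hab.trans hbc)]
  rw [div_lt_div_iff₀ (by linarith) (by linarith)] at *
  linarith

lemma fq_eq' {q a b : ℝ} (hq : 0 < q) (ha : 0 < a) (hab : a < b) :
    fq q a b = (b - a) ^ 2 / (a ^ (-q) - b ^ (-q)) := by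
  rw [fq_eq, wq_eq hq ha hab]; ring

lemma fq_deriv_right {q a b : ℝ} (hq : 0 < q) (ha : 0 ≤ a) (hab : a < b) :
    HasDerivAt (fun t => fq q a t) (2 * wq q a b - q * b ^ (-q - 1) * wq q a b ^ 2) b := by
  rcases ha.eq_or_lt with rfl | ha
  · simp only [fq_eq, wq_zero hq]
    simpa using hasDerivAt_const b (0 : ℝ)
  have hb := ha.trans hab
  have d := rneg_lt hq ha hab
  have h1 : HasDerivAt (fun t : ℝ => (t - a) ^ 2 / (a ^ (-q) - t ^ (-q))) 
      _ b := (((hasDerivAt_id' b).sub_const a).pow 2).div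
        ((Real.hasDerivAt_rpow_const (p := -q) (Or.inl hb.ne')).const_sub (a ^ (-q)))
        (by linarith)
  have h2 : (fun t => fq q a t) =ᶠ[nhds b] (fun t : ℝ => (t - a) ^ 2 / (a ^ (-q) - t ^ (-q))) := by
    filter_upwards [lt_mem_nhds hab] with t ht using fq_eq' hq ha ht
  refine (h1.congr_of_eventuallyEq h2).congr_deriv ?_
  rw [wq_eq hq ha hab]
  have : a ^ (-q) - b ^ (-q) ≠ 0 := by linarith
  simp
  field_simp
  try ring

lemma fq_deriv_left {q a b : ℝ} (hq : 0 < q) (ha : 0 < a) (hab : a < b) :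
    HasDerivAt (fun t => fq q t b) (-2 * wq q a b + q * a ^ (-q - 1) * wq q a b ^ 2) a := by
  have hb := ha.trans hab
  have d := rneg_lt hq ha hab
  have h1 : HasDerivAt (fun t : ℝ => (b - t) ^ 2 / (t ^ (-q) - b ^ (-q))) 
      _ a := (((hasDerivAt_id' a).const_sub b).pow 2).div
        ((Real.hasDerivAt_rpow_const (p := -q) (Or.inl ha.ne')).sub_const (b ^ (-q)))
        (by linarith)
  have h2 : (fun t => fq q t b) =ᶠ[nhds a] (fun t : ℝ => (b - t) ^ 2 / (t ^ (-q) - b ^ (-q))) := by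
    filter_upwards [lt_mem_nhds ha, gt_mem_nhds hab] with t ht ht' using fq_eq' hq ht ht'
  refine (h1.congr_of_eventuallyEq h2).congr_deriv ?_
  rw [wq_eq hq ha hab]
  have : a ^ (-q) - b ^ (-q) ≠ 0 := by linarith
  simp
  field_simp
  try ring

lemma fq_crit {q a b c : ℝ} (hq : 0 < q) (ha : 0 ≤ a) (hab : a < b) (hbc : b < c)
    (hmax : ∀ t, a < t → t < c → fq q a t + fq q t c ≤ fq q a b + fq q b c) :
    q * (wq q a b + wq q b c) = 2 * b ^ (q + 1) := by
  have hb : 0 < b := by linarith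
  have hd := (fq_deriv_right hq ha hab).add (fq_deriv_left hq hb hbc)
  have hloc : IsLocalMax ((fun t => fq q a t) + fun t => fq q t c) b := by
    filter_upwards [lt_mem_nhds hab, gt_mem_nhds hbc] with t ht ht' using hmax t ht ht'
  have h0 := hloc.hasDerivAt_eq_zero hd
  have hw := wq_three hq ha hab hbc
  have hk := Real.rpow_pos_of_pos hb (q + 1)
  rw [show -q - 1 = -(q + 1) by ring, Real.rpow_neg hb.le] at h0
  field_simp at h0
  have : (wq q b c - wq q a b) * (q * (wq q a b + wq q b c) - 2 * b ^ (q + 1)) = 0 := by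
    linarith
  rcases mul_eq_zero.1 this with h | h <;> linarith

lemma fq_cont {q : ℝ} (hq : 0 < q) :
    ContinuousOn (fun z : ℝ × ℝ => fq q z.1 z.2) {z | 0 ≤ z.1 ∧ z.1 ≤ z.2} := by
  rintro ⟨a, b⟩ ⟨ha, hab⟩
  simp only at ha hab
  rcases hab.eq_or_lt with rfl | hab
  · show Filter.Tendsto _ _ _
    simp only [fq_self]
    have hu : Filter.Tendsto (fun z : ℝ × ℝ => (z.2 - z.1) * (z.2 ^ (q + 1) / q))
        (nhdsWithin (a, a) {z | 0 ≤ z.1 ∧ z.1 ≤ z.2}) (nhds 0) := by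
      have : ContinuousAt (fun z : ℝ × ℝ => (z.2 - z.1) * (z.2 ^ (q + 1) / q)) (a, a) := by
        refine ContinuousAt.mul (by fun_prop) (ContinuousAt.div_const ?_ _)
        exact continuousAt_snd.rpow_const (Or.inr (by linarith))
      have h := this.tendsto
      simp only [sub_self, zero_mul] at h
      exact h.mono_left nhdsWithin_le_nhds
    refine tendsto_of_tendsto_of_tendsto_of_le_of_le' tendsto_const_nhds hu ?_ ?_
    · filter_upwards [self_mem_nhdsWithin] with z hz
      rw [fq_eq]; exact mul_nonneg (by linarith [hz.2]) (wq_nonneg hq hz.1 hz.2)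
    · filter_upwards [self_mem_nhdsWithin] with z hz
      rw [fq_eq]
      rcases hz.2.eq_or_lt with h | h
      · simp [h]
      · refine mul_le_mul_of_nonneg_left ?_ (by linarith)
        rw [le_div_iff₀ hq]; linarith [wq_lt hq hz.1 h]
  · refine ContinuousAt.continuousWithinAt ?_
    have h1 : a ^ q < b ^ q := Real.rpow_lt_rpow ha hab hq
    have c1 : ContinuousAt (fun z : ℝ × ℝ => z.1 ^ q) (a, b) :=
      continuousAt_fst.rpow_const (Or.inr hq.le)
    have c2 : ContinuousAt (fun z : ℝ × ℝ => z.2 ^ q) (a, b) :=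
      continuousAt_snd.rpow_const (Or.inr hq.le)
    unfold fq
    exact ((c1.mul c2).mul (by fun_prop)).div (c2.sub c1) (by simp only; linarith)

/-- one step of the ratio comparison -/
lemma ratio_step {q a b c a' b' c' : ℝ} (hq : 0 < q) (ha : 0 ≤ a) (hab : a < b) (hbc : b < c)
    (ha' : 0 ≤ a') (hab' : a' < b') (hbc' : b' < c')
    (h : q * (wq q a b + wq q b c) = 2 * b ^ (q + 1))
    (h' : q * (wq q a' b' + wq q b' c') = 2 * b' ^ (q + 1))
    (hr : a * b' ≤ a' * b) : b * c' ≤ b' * c := by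
  have hb : 0 < b := by linarith
  have hb' : 0 < b' := by linarith
  by_contra! hcon
  have H : wq q (b' * a) (b' * b) ≤ wq q (b * a') (b * b') := by
    rw [mul_comm b' b]
    have h1 : b' * a ≤ b * a' := by linarith
    rcases h1.eq_or_lt with e | e
    · rw [e]
    · exact (wq_mono_left hq (by positivity) e (by nlinarith)).le
  have H' : wq q (b' * b) (b' * c) < wq q (b * b') (b * c') := by
    rw [mul_comm b' b]
    exact wq_mono_right hq (by positivity) (by nlinarith) hcon
  rw [wq_hom hb' (by linarith) (by linarith), wq_hom hb (by linarith) (by linarith)] at H H'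
  have e1 : b' ^ (q + 1) * (q * (wq q a b + wq q b c)) = b ^ (q + 1) * (q * (wq q a' b' + wq q b' c')) := by
    rw [h, h']; ring
  nlinarith

lemma seq_le {q : ℝ} (hq : 0 < q) {n : ℕ} {S T : ℕ → ℝ} 
    (hS0 : 0 ≤ S 0) (hT0 : 0 ≤ T 0) (hn : S n = T n)
    (hS : ∀ i < n, S i < S (i + 1)) (hT : ∀ i < n, T i < T (i + 1))
    (cS : ∀ i, i + 1 < n → q * (wq q (S i) (S (i+1)) + wq q (S (i+1)) (S (i+2))) = 2 * S (i+1) ^ (q+1))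
    (cT : ∀ i, i + 1 < n → q * (wq q (T i) (T (i+1)) + wq q (T (i+1)) (T (i+2))) = 2 * T (i+1) ^ (q+1))
    (h0 : S 0 * T 1 ≤ T 0 * S 1) :
    (∀ i < n, S i * T (i+1) ≤ T i * S (i+1)) ∧ ∀ i ≤ n, S i ≤ T i := by
  have nS : ∀ i ≤ n, 0 ≤ S i := by
    intro i
    induction i with
    | zero => intro _; exact hS0
    | succ k ih => intro h; linarith [ih (by omega), hS k (by omega)]
  have nT : ∀ i ≤ n, 0 ≤ T i := by
    intro i
    induction i with
    | zero => intro _; exact hT0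
    | succ k ih => intro h; linarith [ih (by omega), hT k (by omega)]
  have key : ∀ i < n, S i * T (i+1) ≤ T i * S (i+1) := by
    intro i
    induction i with
    | zero => intro _; exact h0
    | succ k ih =>
      intro h
      exact ratio_step hq (nS k (by omega)) (hS k (by omega)) (hS (k+1) h)
        (nT k (by omega)) (hT k (by omega)) (hT (k+1) h) (cS k h) (cT k h) (ih (by omega))
  refine ⟨key, ?_⟩
  intro i hi
  induction hi using Nat.decreasingInduction with
  | self => exact hn.le
  | of_succ k hk ih =>
    have p1 : 0 < T (k+1) := by linarith [nT k hk.le, hT k hk]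
    have := key k hk
    have := mul_le_mul_of_nonneg_left ih (nT k hk.le)
    exact le_of_mul_le_mul_right (by linarith) p1

lemma seq_unique {q : ℝ} (hq : 0 < q) {n : ℕ} {S T : ℕ → ℝ} 
    (hS0 : 0 ≤ S 0) (h00 : S 0 = T 0) (hn : S n = T n)
    (hS : ∀ i < n, S i < S (i + 1)) (hT : ∀ i < n, T i < T (i + 1))
    (cS : ∀ i, i + 1 < n → q * (wq q (S i) (S (i+1)) + wq q (S (i+1)) (S (i+2))) = 2 * S (i+1) ^ (q+1))
    (cT : ∀ i, i + 1 < n → q * (wq q (T i) (T (i+1)) + wq q (T (i+1)) (T (i+2))) = 2 * T (i+1) ^ (q+1)) :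
    ∀ i ≤ n, S i = T i := by
  wlog hle : S 0 * T 1 ≤ T 0 * S 1 generalizing S T
  · intro i hi
    exact (this (h00 ▸ hS0) h00.symm hn.symm hT hS cT cS (le_of_not_ge hle) i hi).symm
  obtain ⟨k1, k2⟩ := seq_le hq hS0 (h00 ▸ hS0) hn hS hT cS cT hle
  rcases hS0.eq_or_lt with h | h
  · obtain ⟨k3, k4⟩ := seq_le hq (h00 ▸ hS0) hS0 hn.symm hT hS cT cS (by rw [← h00, ← h]; simp)
    intro i hi
    exact le_antisymm (k2 i hi) (k4 i hi)
  · have pS : ∀ i ≤ n, 0 < S i := by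
      intro i
      induction i with
      | zero => intro _; exact h
      | succ k ih => intro h; linarith [ih (by omega), hS k (by omega)]
    intro i
    induction i with
    | zero => intro _; exact h00
    | succ k ih =>
      intro hi
      refine le_antisymm (k2 _ hi) ?_
      have := k1 k hi
      rw [← ih (by omega)] at this
      exact le_of_mul_le_mul_left this (pS k (by omega))


noncomputable def Fsum (q : ℝ) (n : ℕ) (S : ℕ → ℝ) : ℝ :=
  ∑ i ∈ Finset.range n, fq q (S i) (S (i + 1))

lemma Fsum_update (q : ℝ) (n : ℕ) (S : ℕ → ℝ) (k : ℕ) (hk : k + 1 < n) (t : ℝ) :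
    Fsum q n (Function.update S (k + 1) t) + (fq q (S k) (S (k + 1)) + fq q (S (k + 1)) (S (k + 2)))
      = Fsum q n S + (fq q (S k) t + fq q t (S (k + 2))) := by
  have split : ∀ g : ℕ → ℝ, ∑ i ∈ Finset.range n, g i =
      g k + (g (k + 1) + ∑ i ∈ ((Finset.range n).erase k).erase (k + 1), g i) := by
    intro g
    rw [Finset.add_sum_erase _ g (by simp; omega), Finset.add_sum_erase _ g (by simp; omega)]
  unfold Fsum
  rw [split (fun i => fq q (S i) (S (i + 1))),
    split (fun i => fq q (Function.update S (k + 1) t i) (Function.update S (k + 1) t (i + 1)))]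
  have e : ∑ i ∈ ((Finset.range n).erase k).erase (k + 1),
      fq q (Function.update S (k + 1) t i) (Function.update S (k + 1) t (i + 1))
      = ∑ i ∈ ((Finset.range n).erase k).erase (k + 1), fq q (S i) (S (i + 1)) := by
    refine Finset.sum_congr rfl fun i hi => ?_
    simp only [Finset.mem_erase, Finset.mem_range] at hi
    rw [Function.update_of_ne hi.1, Function.update_of_ne (by omega)]
  rw [e]
  simp [Function.update_of_ne]
  ring

lemma xiSeq_zero (l u : ℝ) (n : ℕ) (x : Fin (n - 1) → ℝ) : xiSeq l u n x 0 = l := by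
  simp [xiSeq]

lemma xiSeq_n (l u : ℝ) (n : ℕ) (hn : 2 ≤ n) (x : Fin (n - 1) → ℝ) : xiSeq l u n x n = u := by
  have : n ≠ 0 := by omega
  simp [xiSeq, this]

lemma xiSeq_succ (l u : ℝ) (n : ℕ) (x : Fin (n - 1) → ℝ) (i : Fin (n - 1)) :
    xiSeq l u n x (i + 1) = x i := by
  have : (i : ℕ) + 1 < n := by have := i.2; omega
  simp [xiSeq, this]

lemma xiSeq_update (l u : ℝ) (n : ℕ) (x : Fin (n - 1) → ℝ) (k : Fin (n - 1)) (t : ℝ) :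
    xiSeq l u n (Function.update x k t) = Function.update (xiSeq l u n x) (k + 1) t := by
  funext i
  by_cases h : i = k + 1
  · subst h; rw [xiSeq_succ]; simp
  · rw [Function.update_of_ne h]
    unfold xiSeq
    split_ifs with h1
    · rw [Function.update_of_ne]
      intro h2
      apply h
      rw [← h2]; simp; omega
    · rfl
    · rfl

lemma xiSeq_cont (l u : ℝ) (n i : ℕ) : Continuous fun x => xiSeq l u n x i := by
  unfold xiSeq
  split_ifs <;> fun_prop

lemma Vp_eq (l u p : ℝ) (n : ℕ) (x : Fin (n - 1) → ℝ) :
    Vp l u p n x = -((p - 1) ^ 2 / (6 * p)) * Fsum (p - 1) n (xiSeq l u n x)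
      + (((p - 1) / (6 * p)) * (u ^ (p + 1) - l ^ (p + 1)) - (1 / 6) * (u ^ p * l - u * l ^ p)) := by
  unfold Vp Fsum
  have : ∑ i ∈ Finset.range n, fq (p - 1) (xiSeq l u n x i) (xiSeq l u n x (i + 1)) =
      ∑ i ∈ Finset.Icc 1 n, fq (p - 1) (xiSeq l u n x (i - 1)) (xiSeq l u n x i) := by
    have e : Finset.Icc 1 n = Finset.Ico (0 + 1) (n + 1) := by ext; simp [Nat.succ_le_iff]
    rw [e, ← Finset.sum_Ico_add', Finset.range_eq_Ico]
    simp
  rw [this, add_sub_assoc]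
  rfl

lemma Vp_le_iff {l u p : ℝ} (hp : 1 < p) (n : ℕ) (x y : Fin (n - 1) → ℝ) :
    Vp l u p n x ≤ Vp l u p n y ↔
      Fsum (p - 1) n (xiSeq l u n y) ≤ Fsum (p - 1) n (xiSeq l u n x) := by
  have hK : 0 < (p - 1) ^ 2 / (6 * p) := by
    have : 0 < p - 1 := by linarith
    positivity
  rw [Vp_eq, Vp_eq, add_le_add_iff_right, neg_mul, neg_mul, neg_le_neg_iff,
    mul_le_mul_iff_right₀ hK]

lemma seq_mono {n : ℕ} {S : ℕ → ℝ} (h : ∀ i < n, S i ≤ S (i + 1)) :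
    ∀ j ≤ n, ∀ i ≤ j, S i ≤ S j := by
  intro j hj i hij
  induction j, hij using Nat.le_induction with
  | base => exact le_rfl
  | succ m hm ih => exact (ih (by omega)).trans (h m (by omega))

def clD (l u : ℝ) (n : ℕ) : Set (Fin (n - 1) → ℝ) :=
  {x | ∀ i < n, xiSeq l u n x i ≤ xiSeq l u n x (i + 1)}

lemma clD_compact (l u : ℝ) (n : ℕ) (hn : 2 ≤ n) : IsCompact (clD l u n) := by
  refine IsCompact.of_isClosed_subset (isCompact_Icc (a := fun _ => l) (b := fun _ => u)) ?_ ?_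
  · simp only [clD, Set.ofPred_forall]
    exact isClosed_iInter fun i => isClosed_iInter fun _ =>
      isClosed_le (xiSeq_cont l u n i) (xiSeq_cont l u n (i + 1))
  · intro x hx
    have hm := seq_mono hx
    constructor
    · intro i
      have := hm (i + 1) (by omega) 0 (by omega)
      rwa [xiSeq_zero, xiSeq_succ] at this
    · intro i
      have := hm n le_rfl (i + 1) (by omega)
      rwa [xiSeq_n _ _ _ hn, xiSeq_succ] at this

lemma clD_nonempty (l u : ℝ) (hlu : l < u) (n : ℕ) : (clD l u n).Nonempty := by
  refine ⟨fun _ => l, fun i hi => ?_⟩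
  unfold xiSeq
  split_ifs <;> first | exact le_rfl | exact hlu.le | omega

lemma update_mem (n : ℕ) (R : ℝ → ℝ → Prop) (S : ℕ → ℝ) (hS : ∀ i < n, R (S i) (S (i + 1)))
    (k : ℕ) (t : ℝ) (h1 : R (S k) t) (h2 : R t (S (k + 2))) :
    ∀ i < n, R (Function.update S (k + 1) t i) (Function.update S (k + 1) t (i + 1)) := by
  intro i hi
  by_cases e : i = k
  · subst e; simpa using h1
  by_cases e' : i = k + 1
  · subst e'; simpa using h2
  rw [Function.update_of_ne e', Function.update_of_ne (by omega)]
  exact hS i hi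

lemma clD_nonneg {l u : ℝ} (hl : 0 ≤ l) {n : ℕ} :
    ∀ x ∈ clD l u n, ∀ i ≤ n, 0 ≤ xiSeq l u n x i := by
  intro x hx i hi
  have := seq_mono hx i hi 0 (by omega)
  rw [xiSeq_zero] at this
  linarith

lemma fq_cont_comp {X : Type*} [TopologicalSpace X] {q : ℝ} (hq : 0 < q) {s : Set X} {f g : X → ℝ}
    (hf : Continuous f) (hg : Continuous g) (h : ∀ x ∈ s, 0 ≤ f x ∧ f x ≤ g x) :
    ContinuousOn (fun x => fq q (f x) (g x)) s := by
  have hc : ContinuousOn (fun x => (f x, g x)) s := (hf.prodMk hg).continuousOn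
  exact (fq_cont hq).comp hc h

lemma Fsum_cont {q : ℝ} (hq : 0 < q) (l u : ℝ) (hl : 0 ≤ l) (n : ℕ) :
    ContinuousOn (fun x => Fsum q n (xiSeq l u n x)) (clD l u n) := by
  unfold Fsum
  refine continuousOn_finsetSum _ fun i hi => ?_
  rw [Finset.mem_range] at hi
  exact fq_cont_comp hq (xiSeq_cont l u n i) (xiSeq_cont l u n (i + 1))
    (fun x hx => ⟨clD_nonneg hl x hx i hi.le, hx i hi⟩)

/-- For `1 < p ≤ 2`, the volume function `V_p` has a unique minimizer on `D`. -/
theorem Vp_unique_minimizer_of_p_le_two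
    (l u : ℝ) (hl : 0 ≤ l) (hlu : l < u) (n : ℕ) (hn : 2 ≤ n)
    (p : ℝ) (hp1 : 1 < p) (hp2 : p ≤ 2) :
    ∃! x : Fin (n - 1) → ℝ, x ∈ domD l u n ∧
      ∀ y ∈ domD l u n, Vp l u p n x ≤ Vp l u p n y := by
  simp only [Vp_le_iff hp1]
  have hq : 0 < p - 1 := by linarith
  generalize p - 1 = q at hq
  have hsub : domD l u n ⊆ clD l u n := fun x hx i hi => (hx i hi).le
  have hnn : ∀ x ∈ clD l u n, ∀ i ≤ n, 0 ≤ xiSeq l u n x i := by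
    intro x hx i hi
    have := seq_mono hx i hi 0 (by omega)
    rw [xiSeq_zero] at this
    linarith
  apply existsUnique_of_exists_of_unique
  · obtain ⟨x, hx, hmax⟩ := (clD_compact l u n hn).exists_isMaxOn (clD_nonempty l u hlu n)
      (Fsum_cont hq l u hl n)
    have hmax : ∀ y ∈ clD l u n, Fsum q n (xiSeq l u n y) ≤ Fsum q n (xiSeq l u n x) := hmax
    refine ⟨x, ?_, fun y hy => hmax y (hsub hy)⟩
    have hloc : ∀ k, k + 1 < n → ∀ t, xiSeq l u n x k ≤ t → t ≤ xiSeq l u n x (k + 2) →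
        fq q (xiSeq l u n x k) t + fq q t (xiSeq l u n x (k + 2)) ≤
        fq q (xiSeq l u n x k) (xiSeq l u n x (k + 1))
          + fq q (xiSeq l u n x (k + 1)) (xiSeq l u n x (k + 2)) := by
      intro k hk t h1 h2
      have e := xiSeq_update l u n x ⟨k, by omega⟩ t
      have m := hmax (Function.update x ⟨k, by omega⟩ t) (by
        unfold clD
        rw [Set.mem_ofPred_eq, e]
        exact update_mem n (· ≤ ·) _ hx k t h1 h2)
      rw [e] at m
      have := Fsum_update q n (xiSeq l u n x) k hk t
      simp only at m
      linarith
    have key : ∀ k, k + 1 < n → xiSeq l u n x k < xiSeq l u n x (k + 2) →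
        xiSeq l u n x k < xiSeq l u n x (k + 1) ∧
          xiSeq l u n x (k + 1) < xiSeq l u n x (k + 2) := by
      intro k hk hlt
      have h1 := hloc k hk ((xiSeq l u n x k + xiSeq l u n x (k + 2)) / 2) (by linarith)
        (by linarith)
      have h2 := fq_super (a := xiSeq l u n x k)
        (b := (xiSeq l u n x k + xiSeq l u n x (k + 2)) / 2) (c := xiSeq l u n x (k + 2))
        hq (hnn x hx k (by omega)) (by linarith) (by linarith)
      constructor
      · refine lt_of_le_of_ne (hx k (by omega)) fun e => ?_
        rw [← e, fq_self] at h1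
        linarith
      · refine lt_of_le_of_ne (hx (k + 1) (by omega)) fun e => ?_
        rw [e, fq_self] at h1
        linarith
    have step : ∀ k, k + 1 < n → (xiSeq l u n x k < xiSeq l u n x (k + 1) ↔
        xiSeq l u n x (k + 1) < xiSeq l u n x (k + 2)) := by
      intro k hk
      constructor
      · intro h; exact (key k hk (lt_of_lt_of_le h (hx (k + 1) (by omega)))).2
      · intro h; exact (key k hk (lt_of_le_of_lt (hx k (by omega)) h)).1
    have all : ∀ k < n, (xiSeq l u n x k < xiSeq l u n x (k + 1) ↔
        xiSeq l u n x 0 < xiSeq l u n x 1) := by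
      intro k
      induction k with
      | zero => intro _; rfl
      | succ k ih => intro h; rw [← ih (by omega), step k h]
    by_cases h01 : xiSeq l u n x 0 < xiSeq l u n x 1
    · intro i hi; exact (all i hi).2 h01
    · exfalso
      have : ∀ k ≤ n, xiSeq l u n x k ≤ l := by
        intro k
        induction k with
        | zero => intro _; rw [xiSeq_zero]
        | succ k ih =>
          intro h
          have h1 := mt (all k (by omega)).1 h01
          linarith [ih (by omega)]
      have := this n le_rfl
      rw [xiSeq_n _ _ _ hn] at this
      linarith
  · have crit : ∀ x : Fin (n - 1) → ℝ, x ∈ domD l u n ∧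
        (∀ y ∈ domD l u n, Fsum q n (xiSeq l u n y) ≤ Fsum q n (xiSeq l u n x)) →
        ∀ k, k + 1 < n → q * (wq q (xiSeq l u n x k) (xiSeq l u n x (k + 1))
          + wq q (xiSeq l u n x (k + 1)) (xiSeq l u n x (k + 2)))
            = 2 * xiSeq l u n x (k + 1) ^ (q + 1) := by
      rintro x ⟨hx, hmax⟩ k hk
      refine fq_crit hq (hnn x (hsub hx) k (by omega)) (hx k (by omega)) (hx (k + 1) hk) ?_
      intro t h1 h2
      have e := xiSeq_update l u n x ⟨k, by omega⟩ t
      have m := hmax (Function.update x ⟨k, by omega⟩ t) (by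
        unfold domD
        rw [Set.mem_ofPred_eq, e]
        exact update_mem n (· < ·) _ hx k t h1 h2)
      rw [e] at m
      have := Fsum_update q n (xiSeq l u n x) k hk t
      simp only at m
      linarith
    intro x y hx hy
    have := seq_unique hq (n := n) (S := xiSeq l u n x) (T := xiSeq l u n y)
      (by rw [xiSeq_zero]; exact hl) (by rw [xiSeq_zero, xiSeq_zero])
      (by rw [xiSeq_n _ _ _ hn, xiSeq_n _ _ _ hn]) hx.1 hy.1 (crit x hx) (crit y hy)
    funext i
    have := this (i + 1) (by omega)
    rwa [xiSeq_succ, xiSeq_succ] at this
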